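/- Let 0 ≤ r_1 < r_2 < ⋯ < r_k be integers, let n = 3^{r_1} + ⋯ + 3^{r_k}, and suppose that the number of indices i with r_i odd is odd. Let h ∈ S_n be a product of k disjoint cycles of lengths 3^{r_1}, …, 3^{r_k} whose supports together cover all of {1,…,n}. Then h lies in the alternating group A_n, and the focal subgroup Φ^{A_n}(⟨h⟩) of the cyclic subgroup generated by h is contained in ⟨h³⟩; in particular h ∉ Φ^{A_n}(⟨h⟩), so the image of h in F(A_n, ⟨h⟩) has order divisible by 3 when n ≥ 5. -/

import Mathlib

set_option synthInstance.maxHeartbeats 1000000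
set_option maxHeartbeats 1000000

/-- The set of generators of the focal subgroup of `H` in `G`. -/
def focalSet {G : Type*} [Group G] (H : Subgroup G) : Set G :=
  {x : G | ∃ h ∈ H, ∃ g : G, g⁻¹ * h * g ∈ H ∧ x = h⁻¹ * (g⁻¹ * h * g)}

/-- The focal subgroup `Φ^G(H)` of a subgroup `H` of `G`. -/
def focal {G : Type*} [Group G] (H : Subgroup G) : Subgroup G :=
  Subgroup.closure (focalSet H)

theorem focal_conj_mem {G : Type*} [Group G] (H : Subgroup G) {c x : G}
    (hc : c ∈ H) (hx : x ∈ focal H) : c⁻¹ * x * c ∈ focal H := by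
  have hx' : x ∈ Subgroup.closure (focalSet H) := hx
  clear hx
  induction hx' using Subgroup.closure_induction with
  | mem s hs =>
      obtain ⟨a, ha, g, hg, rfl⟩ := hs
      apply Subgroup.subset_closure
      refine ⟨c⁻¹ * a * c, H.mul_mem (H.mul_mem (H.inv_mem hc) ha) hc,
        c⁻¹ * g * c, ?_, ?_⟩
      · have h1 : (c⁻¹ * g * c)⁻¹ * (c⁻¹ * a * c) * (c⁻¹ * g * c)
            = c⁻¹ * (g⁻¹ * a * g) * c := by group
        rw [h1]
        exact H.mul_mem (H.mul_mem (H.inv_mem hc) hg) hc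
      · group
  | one => simpa using (focal H).one_mem
  | mul x y hxm hym ihx ihy =>
      have h2 : c⁻¹ * (x * y) * c = (c⁻¹ * x * c) * (c⁻¹ * y * c) := by group
      rw [h2]; exact (focal H).mul_mem ihx ihy
  | inv x hxm ih =>
      have h3 : c⁻¹ * x⁻¹ * c = (c⁻¹ * x * c)⁻¹ := by group
      rw [h3]; exact (focal H).inv_mem ih

instance focal_subgroupOf_normal {G : Type*} [Group G] (H : Subgroup G) :
    ((focal H).subgroupOf (H ⊓ commutator G)).Normal := by
  constructor
  intro x hx k
  rw [Subgroup.mem_subgroupOf] at hx ⊢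
  have hk : (k : G) ∈ H := (Subgroup.mem_inf.mp k.2).1
  have h := focal_conj_mem H (H.inv_mem hk) hx
  rw [inv_inv] at h
  simpa using h

/-- `F(G,H) = (H ∩ [G,G]) / Φ^G(H)`. -/
abbrev FGroup {G : Type*} [Group G] (H : Subgroup G) :=
  ↥(H ⊓ commutator G) ⧸ ((focal H).subgroupOf (H ⊓ commutator G))

namespace Equiv.Perm

variable {α : Type*} [Fintype α] [DecidableEq α]

theorem IsCycle.exists_conj_eq_inv {σ : Perm α} (hσ : σ.IsCycle) (hodd : Odd σ.support.card) :
    ∃ g : Perm α, g * σ = σ⁻¹ * g ∧ g.support ⊆ σ.support ∧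
      Perm.sign g = ((-1) ^ (σ.support.card / 2) : ℤˣ) := by
  have hcard : Fintype.card (Subgroup.zpowers σ) = σ.support.card := by
    rw [Fintype.card_zpowers, hσ.orderOf]
  let e : Subgroup.zpowers σ ≃ {x // x ∈ σ.support} := hσ.zpowersEquivSupport
  have hmul (τ : Subgroup.zpowers σ) :
      ((e (⟨σ, Subgroup.mem_zpowers σ⟩ * τ) : {x // x ∈ σ.support}) : α) = σ (e τ) := rfl
  have hmul' (τ : Subgroup.zpowers σ) :
      ((e (⟨σ, Subgroup.mem_zpowers σ⟩⁻¹ * τ) : {x // x ∈ σ.support}) : α) = σ⁻¹ (e τ) := rfl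
  refine ⟨(Equiv.inv (Subgroup.zpowers σ)).extendDomain e, ?_, ?_, ?_⟩
  · ext y
    by_cases hy : y ∈ σ.support
    · obtain ⟨τ, hτ⟩ := e.surjective ⟨y, hy⟩
      obtain rfl : (e τ : α) = y := by rw [hτ]
      rw [mul_apply, mul_apply, ← hmul, extendDomain_apply_image, extendDomain_apply_image,
        Equiv.inv_apply, ← hmul', mul_inv_rev]
      exact congrArg (fun t => (e t : α)) (IsMulCommutative.is_comm.comm _ _)
    · have hy' : σ y = y := by simpa using hy
      rw [mul_apply, mul_apply, hy', extendDomain_apply_not_subtype _ _ hy, eq_comm,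
        inv_eq_iff_eq, hy']
  · intro y hy
    by_contra hy'
    exact mem_support.1 hy (extendDomain_apply_not_subtype _ _ hy')
  · rw [sign_extendDomain, sign_of_pow_two_eq_one (by ext; simp [sq]), hcard]
    have hfix : Fintype.card (Function.fixedPoints (Equiv.inv (Subgroup.zpowers σ))) = 1 := by
      rw [Fintype.card_eq_one_iff]
      refine ⟨⟨1, by simp [Function.mem_fixedPoints, Function.IsFixedPt]⟩, ?_⟩
      rintro ⟨τ, hτ⟩
      have hτ' : τ⁻¹ = τ := hτ
      have h2 : τ ^ 2 = 1 := by rw [sq, ← mul_inv_cancel τ, hτ']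
      have hodd' : Nat.Coprime 2 (Fintype.card (Subgroup.zpowers σ)) := by
        rw [hcard]; exact Nat.coprime_two_left.2 hodd
      have h3 : orderOf τ = 1 :=
        Nat.dvd_one.1 (hodd' ▸ Nat.dvd_gcd (orderOf_dvd_of_pow_eq_one h2) orderOf_dvd_card)
      exact Subtype.ext (orderOf_eq_one_iff.1 h3)
    rw [hfix]
    congr 1
    obtain ⟨j, hj⟩ := hodd
    omega

/-- A permutation with cycles of odd lengths is inverted by a permutation that acts
on each cycle as a reflection. -/
theorem exists_conj_eq_inv (σ : Perm α) (hodd : ∀ c ∈ σ.cycleType, Odd c) :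
    ∃ g : Perm α, g * σ = σ⁻¹ * g ∧ g.support ⊆ σ.support ∧
      sign g = (σ.cycleType.map fun c => (-1 : ℤˣ) ^ (c / 2)).prod := by
  induction σ using cycle_induction_on with
  | base_one => exact ⟨1, by simp⟩
  | base_cycles σ hσ =>
    simpa [hσ.cycleType] using IsCycle.exists_conj_eq_inv hσ (hodd _ (by simp [hσ.cycleType]))
  | induction_disjoint σ τ hd _ ihσ ihτ =>
    simp only [hd.cycleType_mul, Multiset.mem_add] at hodd
    obtain ⟨a, ha, hsa, hsgna⟩ := ihσ fun c hc => hodd c (.inl hc)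
    obtain ⟨b, hb, hsb, hsgnb⟩ := ihτ fun c hc => hodd c (.inr hc)
    have hbσ : Commute b σ := (disjoint_iff_disjoint_support.2
      (hd.symm.disjoint_support.mono_left hsb)).commute
    have haτ : Commute a τ := (disjoint_iff_disjoint_support.2
      (hd.disjoint_support.mono_left hsa)).commute
    refine ⟨a * b, ?_, ?_, ?_⟩
    · calc a * b * (σ * τ) = a * (b * σ) * τ := by group
        _ = (a * σ) * (b * τ) := by rw [hbσ.eq]; group
        _ = σ⁻¹ * (a * τ⁻¹) * b := by rw [ha, hb]; group
        _ = (σ⁻¹ * τ⁻¹) * (a * b) := by rw [haτ.inv_right.eq]; group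
        _ = (σ * τ)⁻¹ * (a * b) := by rw [hd.commute.eq, mul_inv_rev]
    · rw [hd.support_mul]
      exact (support_mul_le a b).trans (Finset.union_subset_union hsa hsb)
    · rw [hd.cycleType_mul, Multiset.map_add, Multiset.prod_add, sign_mul, hsgna, hsgnb]

theorem sign_eq_neg_one_of_conj_eq_inv {σ x : Perm α} (hodd : ∀ c ∈ σ.cycleType, Odd c)
    (hcard : Fintype.card α ≤ σ.cycleType.sum + 1) (hnodup : σ.cycleType.Nodup)
    (hprod : (σ.cycleType.map fun c => (-1 : ℤˣ) ^ (c / 2)).prod = -1)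
    (hx : x⁻¹ * σ * x = σ⁻¹) : sign x = -1 := by
  obtain ⟨g, hg, -, hsgn⟩ := σ.exists_conj_eq_inv hodd
  have hmem : x * g ∈ Subgroup.centralizer {σ} := by
    rw [Subgroup.mem_centralizer_singleton_iff]
    calc x * g * σ = x * σ⁻¹ * g := by rw [mul_assoc, hg]; group
      _ = σ * (x * g) := by
        have : x * σ⁻¹ = σ * x := by rw [← hx]; group
        rw [this, mul_assoc]
  have h1 := centralizer_le_alternating_iff.2
    ⟨hodd, hcard, fun i => Multiset.nodup_iff_count_le_one.1 hnodup i⟩ hmem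
  rw [mem_alternatingGroup, sign_mul, hsgn, hprod] at h1
  simpa [neg_eq_iff_eq_neg] using h1

end Equiv.Perm

theorem neg_one_pow_three_pow_half (r : ℕ) : (-1 : ℤˣ) ^ (3 ^ r / 2) = (-1) ^ r := by
  induction r with
  | zero => simp
  | succ r ih =>
    obtain ⟨j, hj⟩ : Odd (3 ^ r) := Odd.pow (by decide)
    have h1 : 3 ^ (r + 1) / 2 = 3 ^ r / 2 + 1 + 2 * j := by omega
    rw [h1, pow_add, pow_mul, pow_add, ih]
    simp [pow_succ]

theorem focal_zpowers_le_zpowers_cube {G : Type*} [Group G] {h : G} {m : ℕ}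
    (horder : orderOf h = 3 ^ (m + 1)) (hinv : ∀ x : G, x⁻¹ * h * x ≠ h⁻¹) :
    focal (Subgroup.zpowers h) ≤ Subgroup.zpowers (h ^ 3) := by
  have hone (j : ℤ) : h ^ j = 1 ↔ (3 : ℤ) ^ (m + 1) ∣ j := by
    rw [← orderOf_dvd_iff_zpow_eq_one, horder]; norm_cast
  have hconj (g : G) (s j : ℤ) : g⁻¹ * h ^ (s * j) * g = (g⁻¹ * h ^ s * g) ^ j := by
    have := (map_zpow (MulAut.conj g⁻¹) (h ^ s) j)
    simpa [zpow_mul] using this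
  have hthree (j : ℤ) : h ^ (j * 3 ^ m) = 1 ↔ (3 : ℤ) ∣ j := by
    rw [hone, pow_succ', mul_dvd_mul_iff_right (by positivity)]
  rw [focal, Subgroup.closure_le]
  rintro _ ⟨_, ⟨a, rfl⟩, g, ⟨b, hb⟩, rfl⟩
  simp only at hb ⊢
  rw [← hb]
  suffices hdvd : (3 : ℤ) ∣ b - a by
    obtain ⟨j, hj⟩ := hdvd
    refine ⟨j, ?_⟩
    simp only
    rw [← zpow_neg, ← zpow_add, neg_add_eq_sub, hj, zpow_mul]
    norm_cast
  have hab : (3 : ℤ) ∣ a ↔ (3 : ℤ) ∣ b := by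
    rw [← hthree, ← hthree, zpow_mul h b, hb, ← hconj]
    constructor
    · intro h1; rw [h1]; group
    · intro h1
      have : h ^ (a * 3 ^ m) = g * (g⁻¹ * h ^ (a * 3 ^ m) * g) * g⁻¹ := by group
      rw [this, h1]; group
  by_contra hndvd
  have ha : ¬ (3 : ℤ) ∣ a := fun ha => hndvd (dvd_sub (hab.1 ha) ha)
  have ha' : a % 3 = 1 ∨ a % 3 = 2 := by omega
  have hb' : b % 3 = 1 ∨ b % 3 = 2 := by omega
  have hsum : (3 : ℤ) ∣ a + b := by omega
  have hcop : IsCoprime a ((3 : ℤ) ^ (m + 1)) :=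
    ((Int.prime_three.coprime_iff_not_dvd.2 ha).symm).pow_right
  obtain ⟨u, v, huv⟩ := hcop
  set c := b * u with hc
  have hgc : g⁻¹ * h * g = h ^ c := by
    have h1 : h ^ (a * u) = h := by
      have : a * u = 1 + 3 ^ (m + 1) * (-v) := by linear_combination huv
      rw [this, zpow_add, (hone _).2 ⟨-v, rfl⟩]; simp
    rw [hc, zpow_mul, hb, ← hconj, h1]
  have hiter (k : ℕ) : (g ^ k)⁻¹ * h * g ^ k = h ^ (c ^ k) := by
    induction k with
    | zero => simp
    | succ k ih =>
      calc (g ^ (k + 1))⁻¹ * h * g ^ (k + 1) = g⁻¹ * ((g ^ k)⁻¹ * h * g ^ k) * g := by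
            rw [pow_succ]; group
        _ = h ^ (c ^ (k + 1)) := by
          rw [ih, ← one_mul (c ^ k), hconj, zpow_one, hgc, ← zpow_mul, pow_succ']
  have hc1 : ((3 : ℕ) : ℤ) ∣ c - (-1) := by
    have h1 : (3 : ℤ) ∣ a * (c + 1) := by
      have : a * (c + 1) = (a + b) + 3 * (-(3 ^ m * v * b)) := by
        rw [hc]; linear_combination b * huv
      rw [this]
      exact dvd_add hsum (dvd_mul_right _ _)
    simpa using (Int.prime_three.dvd_or_dvd h1).resolve_left ha
  have hc2 := dvd_sub_pow_of_dvd_sub hc1 m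
  rw [Odd.neg_one_pow (Odd.pow (by decide)), sub_neg_eq_add] at hc2
  refine hinv (g ^ 3 ^ m) ?_
  rw [hiter, eq_inv_iff_mul_eq_one, ← zpow_add_one, hone]
  exact_mod_cast hc2

/-- Let `0 ≤ r₁ < ⋯ < r_k`, `n = 3^{r₁} + ⋯ + 3^{r_k}`, with an odd number of
odd `r i`. Let `h ∈ Sₙ` be a product of `k` disjoint cycles of lengths `3^{r i}` whose supports
cover `{1, …, n}` (encoded via the cycle type: cycles of length `1` are trivial). Then `h` lies
in `Aₙ`, the focal subgroup `Φ^{Aₙ}(⟨h⟩)` is contained in `⟨h³⟩`, in particular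
`h ∉ Φ^{Aₙ}(⟨h⟩)`, and when `n ≥ 5` the image of `h` in `F(Aₙ, ⟨h⟩)` has order divisible
by `3`. -/
theorem focal_zpowers_le_of_three_power_cycleType (k : ℕ) (r : Fin k → ℕ)
    (hr : StrictMono r)
    (hodd : Odd (Finset.univ.filter fun i => Odd (r i)).card)
    (n : ℕ) (hn : n = ∑ i, 3 ^ (r i))
    (h : Equiv.Perm (Fin n))
    (hct : h.cycleType =
      Multiset.filter (fun a => a ≠ 1)
        (Multiset.map (fun i => 3 ^ (r i)) Finset.univ.val)) :
    ∃ hA : h ∈ alternatingGroup (Fin n),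
      focal (Subgroup.zpowers (⟨h, hA⟩ : ↥(alternatingGroup (Fin n)))) ≤
        Subgroup.zpowers ((⟨h, hA⟩ : ↥(alternatingGroup (Fin n))) ^ 3) ∧
      (⟨h, hA⟩ : ↥(alternatingGroup (Fin n))) ∉
        focal (Subgroup.zpowers (⟨h, hA⟩ : ↥(alternatingGroup (Fin n)))) ∧
      (5 ≤ n →
        ∀ hc : (⟨h, hA⟩ : ↥(alternatingGroup (Fin n))) ∈
            commutator ↥(alternatingGroup (Fin n)),
          3 ∣ orderOf
            ((QuotientGroup.mk
              (⟨⟨h, hA⟩, Subgroup.mem_inf.mpr ⟨Subgroup.mem_zpowers _, hc⟩⟩ :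
                ↥(Subgroup.zpowers (⟨h, hA⟩ : ↥(alternatingGroup (Fin n))) ⊓
                  commutator ↥(alternatingGroup (Fin n))))) :
              FGroup (Subgroup.zpowers (⟨h, hA⟩ : ↥(alternatingGroup (Fin n)))))) := by
  have hcycle (c : ℕ) (hc : c ∈ h.cycleType) : ∃ i, 3 ^ r i = c := by
    rw [hct] at hc
    simpa using (Multiset.mem_filter.1 hc).1
  have hoddc (c : ℕ) (hc : c ∈ h.cycleType) : Odd c := by
    obtain ⟨i, rfl⟩ := hcycle c hc
    exact Odd.pow (by decide)
  have hpow : Function.Injective fun i => 3 ^ r i :=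
    (Nat.pow_right_injective (by norm_num : 2 ≤ 3)).comp hr.injective
  have hnodup : h.cycleType.Nodup := by
    rw [hct]
    exact (Finset.univ.nodup.map hpow).filter _
  have hcard : Fintype.card (Fin n) ≤ h.cycleType.sum + 1 := by
    have hsplit := congrArg Multiset.sum (Multiset.filter_add_not (fun a => a ≠ 1)
      (Multiset.map (fun i => 3 ^ (r i)) Finset.univ.val))
    rw [Multiset.sum_add, ← hct] at hsplit
    have hle : (Multiset.filter (fun a => ¬ a ≠ 1)
        (Multiset.map (fun i => 3 ^ (r i)) Finset.univ.val)).sum ≤ 1 := by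
      simp only [not_not, Multiset.filter_eq', Multiset.sum_replicate, smul_eq_mul, mul_one]
      exact Multiset.nodup_iff_count_le_one.1 (Finset.univ.nodup.map hpow) 1
    have hn' : n = (Multiset.map (fun i => 3 ^ (r i)) Finset.univ.val).sum := hn
    rw [Fintype.card_fin]
    omega
  have hprod : (h.cycleType.map fun c => (-1 : ℤˣ) ^ (c / 2)).prod = -1 := by
    have hsplit := congrArg (fun s => (s.map fun c => (-1 : ℤˣ) ^ (c / 2)).prod)
      (Multiset.filter_add_not (fun a => a ≠ 1)
        (Multiset.map (fun i => 3 ^ (r i)) Finset.univ.val))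
    simp only [Multiset.map_add, Multiset.prod_add, not_not, Multiset.filter_eq',
      Multiset.map_replicate, Multiset.prod_replicate, Multiset.map_map, ← hct] at hsplit
    rw [Nat.div_eq_of_lt one_lt_two, pow_zero, one_pow, mul_one] at hsplit
    rw [hsplit]
    change ∏ i, (-1 : ℤˣ) ^ (3 ^ r i / 2) = -1
    simp_rw [neg_one_pow_three_pow_half]
    refine Eq.trans ?_ (hodd.neg_one_pow (α := ℤˣ))
    rw [← Finset.prod_const, Finset.prod_filter]
    refine Finset.prod_congr rfl fun i _ => ?_
    split_ifs with hi
    · exact hi.neg_one_pow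
    · exact (Nat.not_odd_iff_even.1 hi).neg_one_pow
  obtain ⟨i₀, hi₀⟩ := Finset.card_pos.1 hodd.pos
  replace hi₀ : Odd (r i₀) := (Finset.mem_filter.1 hi₀).2
  obtain ⟨m, horder⟩ : ∃ m, orderOf h = 3 ^ (m + 1) := by
    have hdvd : orderOf h ∣ 3 ^ ∑ i, r i := by
      rw [← Equiv.Perm.lcm_cycleType, Multiset.lcm_dvd]
      intro c hc
      obtain ⟨i, rfl⟩ := hcycle c hc
      exact pow_dvd_pow 3 (Finset.single_le_sum (fun _ _ => Nat.zero_le _) (Finset.mem_univ i))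
    obtain ⟨m, -, hm⟩ := (Nat.dvd_prime_pow Nat.prime_three).1 hdvd
    have hmem : 3 ^ r i₀ ∈ h.cycleType := by
      rw [hct, Multiset.mem_filter]
      exact ⟨Multiset.mem_map_of_mem _ (Finset.mem_univ i₀),
        (Nat.one_lt_pow hi₀.pos.ne' (by norm_num)).ne'⟩
    have hle := (Nat.pow_dvd_pow_iff_le_right (by norm_num)).1
      (hm ▸ Equiv.Perm.dvd_of_mem_cycleType hmem)
    obtain ⟨m, rfl⟩ := Nat.exists_eq_succ_of_ne_zero (hi₀.pos.trans_le hle).ne'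
    exact ⟨m, hm⟩
  have hA : h ∈ alternatingGroup (Fin n) := by
    rw [Equiv.Perm.mem_alternatingGroup, Equiv.Perm.sign_of_cycleType']
    refine Multiset.prod_eq_one fun x hx => ?_
    obtain ⟨c, hc, rfl⟩ := Multiset.mem_map.1 hx
    rw [(hoddc c hc).neg_one_pow, neg_neg]
  have horderA : orderOf (⟨h, hA⟩ : alternatingGroup (Fin n)) = 3 ^ (m + 1) := by
    rw [Subgroup.orderOf_mk, horder]
  have hfocal := focal_zpowers_le_zpowers_cube horderA fun x hx => by
    have hx1 := Equiv.Perm.sign_eq_neg_one_of_conj_eq_inv hoddc hcard hnodup hprod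
      (congrArg Subtype.val hx)
    rw [Equiv.Perm.mem_alternatingGroup.1 x.2] at hx1
    exact absurd hx1 (by decide)
  have hdvd (j : ℕ) (hj : (⟨h, hA⟩ : alternatingGroup (Fin n)) ^ j ∈
      focal (Subgroup.zpowers (⟨h, hA⟩ : alternatingGroup (Fin n)))) : 3 ∣ j := by
    obtain ⟨i, hi⟩ := hfocal hj
    simp only at hi
    rw [← zpow_natCast, ← zpow_natCast, ← zpow_mul, zpow_eq_zpow_iff_modEq, horderA] at hi
    have h3 := hi.dvd
    have h4 : (3 : ℤ) ∣ (j : ℤ) - (3 : ℕ) * i :=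
      dvd_trans (by push_cast; exact dvd_pow_self 3 (by omega)) h3
    omega
  refine ⟨hA, hfocal, fun hmem => ?_, fun _ hc => hdvd _ ?_⟩
  · exact absurd (hdvd 1 (by rwa [pow_one])) (by norm_num)
  · have hpo := pow_orderOf_eq_one ((QuotientGroup.mk
      (⟨⟨h, hA⟩, Subgroup.mem_inf.mpr ⟨Subgroup.mem_zpowers _, hc⟩⟩ :
        ↥(Subgroup.zpowers (⟨h, hA⟩ : ↥(alternatingGroup (Fin n))) ⊓
          commutator ↥(alternatingGroup (Fin n))))) :
      FGroup (Subgroup.zpowers (⟨h, hA⟩ : ↥(alternatingGroup (Fin n)))))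
    rw [← QuotientGroup.mk_pow, QuotientGroup.eq_one_iff, Subgroup.mem_subgroupOf] at hpo
    exact hpo
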